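/- Assume in addition that F is essentially surjective. Let (C•,d) be a cochain complex in 𝒞. Then the natural functor from lifts of (C•,d) along the induced functor C(F) on categories of cochain complexes to lifts of (C•,d) along the induced functor K(F) on homotopy categories is essentially surjective; concretely, for every cochain complex (D̄•,d̄_D) in 𝒞̄ with a homotopy equivalence φ : (C•,d) → F(D̄•,d̄_D), there exists a cochain complex (Ē•,d̄_E) in 𝒞̄ together with an isomorphism of cochain complexes (C•,d) ≅ F(Ē•,d̄_E) and a homotopy equivalence (Ē•,d̄_E) → (D̄•,d̄_D) compatible with φ up to homotopy. -/

import Mathlib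

open CategoryTheory

namespace Paper

/-- A graded object: a `ℤ`-indexed family of objects. -/
abbrev GradedObj (A : Type*) [Category A] := ℤ → A

/-- A graded map of degree `n` from `X` to `Y`. -/
abbrev GMap {A : Type*} [Category A] (X Y : GradedObj A) (n : ℤ) :=
  ∀ i : ℤ, X i ⟶ Y (i + n)

/-- Composition of graded maps, in diagrammatic order (`gcomp h f g` is "`g ∘ f`"),
with prescribed total degree `k = n + m`. -/
def gcomp {A : Type*} [Category A] {X Y Z : GradedObj A} {n m k : ℤ} (h : n + m = k)
    (f : GMap X Y n) (g : GMap Y Z m) : GMap X Z k :=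
  fun i => f i ≫ g (i + n) ≫ eqToHom (congrArg Z (show i + n + m = i + k by omega))

/-- The identity graded map of degree `0`. -/
def gid {A : Type*} [Category A] (X : GradedObj A) : GMap X X 0 :=
  fun i => eqToHom (congrArg X (add_zero i).symm)

/-- `δ(f) = d_Y ∘ f - (-1)ⁿ ⬝ f ∘ d_X` for pre-differentials `d_X`, `d_Y` and a graded
map `f` of degree `n`; the result has degree `m = n + 1`. -/
def gdelta {A : Type*} [Category A] [Preadditive A] {X Y : GradedObj A}
    (dX : GMap X X 1) (dY : GMap Y Y 1) {n m : ℤ} (h : n + 1 = m) (f : GMap X Y n) :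
    GMap X Y m :=
  gcomp h f dY - (n.negOnePow : ℤ) • gcomp (show 1 + n = m by omega) dX f

/-- The image of a graded object under a functor. -/
abbrev Fgr {A B : Type*} [Category A] [Category B] (F : B ⥤ A) (X : GradedObj B) :
    GradedObj A := fun i => F.obj (X i)

/-- The image of a graded map under a functor. -/
def Fmap {A B : Type*} [Category A] [Category B] (F : B ⥤ A) {X Y : GradedObj B} {n : ℤ}
    (f : GMap X Y n) : GMap (Fgr F X) (Fgr F Y) n := fun i => F.map (f i)

/-- `Ker(F)² = 0`: the composite of two `F`-killed morphisms vanishes. -/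
def KerSq {A B : Type*} [Category A] [Category B] [Preadditive A] [Preadditive B]
    (F : B ⥤ A) : Prop :=
  ∀ ⦃X Y Z : B⦄ (u : X ⟶ Y) (v : Y ⟶ Z), F.map u = 0 → F.map v = 0 → u ≫ v = 0

/-- `f : (X,dX) → (Y,dY)` and `g : (Y,dY) → (X,dX)` are cochain maps which are homotopy
inverse to each other. -/
def IsHomotopyEquivPair {A : Type*} [Category A] [Preadditive A] {X Y : GradedObj A}
    (dX : GMap X X 1) (dY : GMap Y Y 1) (f : GMap X Y 0) (g : GMap Y X 0) : Prop :=
  gdelta dX dY (show (0:ℤ) + 1 = 1 by omega) f = 0 ∧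
  gdelta dY dX (show (0:ℤ) + 1 = 1 by omega) g = 0 ∧
  (∃ H : GMap X X (-1), gdelta dX dX (show (-1:ℤ) + 1 = 0 by omega) H
      = gid X - gcomp (show (0:ℤ) + 0 = 0 by omega) f g) ∧
  (∃ K : GMap Y Y (-1), gdelta dY dY (show (-1:ℤ) + 1 = 0 by omega) K
      = gid Y - gcomp (show (0:ℤ) + 0 = 0 by omega) g f)

/-- The additive group of all families of morphisms into the components of graded objects. -/
abbrev Probes (A : Type*) [Category A] [Preadditive A] :=
  ∀ (T : A) (X : GradedObj A) (i : ℤ), T ⟶ X i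

open Classical in
/-- The action of graded maps on probes by postcomposition. It turns `gcomp` into the product of
a ring, in which the degrees of graded maps are no longer visible. -/
noncomputable def toEnd {A : Type*} [Category A] [Preadditive A] {X Y : GradedObj A} {n : ℤ}
    (f : GMap X Y n) : AddMonoid.End (Probes A) where
  toFun m T := Pi.single Y fun j =>
    m T X (j - n) ≫ f (j - n) ≫ eqToHom (congrArg Y (sub_add_cancel j n))
  map_zero' := by
    funext T Z j
    by_cases h : Z = Y
    · subst h; simp
    · exact congrFun ((Pi.single_eq_of_ne h _).trans rfl) j
  map_add' m m' := by
    funext T Z j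
    by_cases h : Z = Y
    · subst h; simp
    · have (c : ∀ j, T ⟶ Y j) : Pi.single (M := fun Y : GradedObj A => ∀ j, T ⟶ Y j) Y c Z = 0 :=
        Pi.single_eq_of_ne h _
      simp [this]

section toEnd

variable {A : Type*} [Category A] [Preadditive A] {X Y Z : GradedObj A} {n m k : ℤ}

open Classical in
lemma toEnd_apply (f : GMap X Y n) (w : Probes A) (T : A) {i j : ℤ} (h : i + n = j) :
    toEnd f w T Y j = w T X i ≫ f i ≫ eqToHom (congrArg Y h) := by
  obtain rfl : i = j - n := by omega
  exact congrFun (Pi.single_eq_same (M := fun Y : GradedObj A => ∀ j, T ⟶ Y j) Y _) j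

open Classical in
lemma toEnd_apply_of_ne (f : GMap X Y n) (w : Probes A) (T : A) (h : Z ≠ Y) :
    toEnd f w T Z = 0 :=
  Pi.single_eq_of_ne (M := fun Y : GradedObj A => ∀ j, T ⟶ Y j) h _

lemma toEnd_ext {r s : AddMonoid.End (Probes A)} (Y : GradedObj A)
    (hr : ∀ w T Z, Z ≠ Y → r w T Z = 0) (hs : ∀ w T Z, Z ≠ Y → s w T Z = 0)
    (h : ∀ w T j, r w T Y j = s w T Y j) : r = s := by
  refine AddMonoidHom.ext fun w => ?_
  funext T Z j
  by_cases hZ : Z = Y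
  · subst hZ; exact h w T j
  · exact congrFun ((hr w T Z hZ).trans (hs w T Z hZ).symm) j

lemma toEnd_injective : Function.Injective (toEnd : GMap X Y n → _) := by
  classical
  intro f g hfg
  funext i
  have h := congrFun (congrFun (congrFun (DFunLike.congr_fun hfg
    (Pi.single (X i) (Pi.single X (Pi.single i (𝟙 (X i)))))) (X i)) Y) (i + n)
  simpa [toEnd_apply _ _ _ rfl] using h

@[simp]
lemma toEnd_zero : toEnd (0 : GMap X Y n) = 0 := by
  refine toEnd_ext Y (fun w T Z h => toEnd_apply_of_ne _ w T h) (fun _ _ _ _ => rfl) ?_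
  intro w T j
  simp [toEnd_apply _ w T (sub_add_cancel j n)]

@[simp]
lemma toEnd_add (f g : GMap X Y n) : toEnd (f + g) = toEnd f + toEnd g := by
  refine toEnd_ext Y (fun w T Z h => toEnd_apply_of_ne _ w T h) ?_ ?_
  · intro w T Z h
    change toEnd f w T Z + toEnd g w T Z = 0
    simp [toEnd_apply_of_ne _ w T h]
  · intro w T j
    change _ = toEnd f w T Y j + toEnd g w T Y j
    simp [toEnd_apply _ w T (sub_add_cancel j n)]

@[simp]
lemma toEnd_neg (f : GMap X Y n) : toEnd (-f) = -toEnd f := by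
  rw [eq_neg_iff_add_eq_zero, ← toEnd_add, neg_add_cancel, toEnd_zero]

@[simp]
lemma toEnd_sub (f g : GMap X Y n) : toEnd (f - g) = toEnd f - toEnd g := by
  rw [sub_eq_add_neg, toEnd_add, toEnd_neg, sub_eq_add_neg]

@[simp]
lemma toEnd_gcomp (h : n + m = k) (f : GMap X Y n) (g : GMap Y Z m) :
    toEnd (gcomp h f g) = toEnd g * toEnd f := by
  refine toEnd_ext Z (fun w T Z h => toEnd_apply_of_ne _ w T h) ?_ ?_
  · intro w T Z h
    simp [toEnd_apply_of_ne _ _ T h]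
  · intro w T j
    simp [toEnd_apply _ _ T (show j - k + k = j by omega),
      toEnd_apply _ _ T (show j - k + n + m = j by omega), toEnd_apply _ _ T rfl, gcomp]

lemma toEnd_gid_apply (w : Probes A) (T : A) (j : ℤ) : toEnd (gid X) w T X j = w T X j := by
  simp [toEnd_apply _ w T (add_zero j), gid]

@[simp]
lemma toEnd_gid_mul (f : GMap X Y n) : toEnd (gid Y) * toEnd f = toEnd f := by
  refine toEnd_ext Y ?_ (fun w T Z h => toEnd_apply_of_ne _ w T h) ?_
  · intro w T Z h
    simp [toEnd_apply_of_ne _ _ T h]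
  · intro w T j
    simp [toEnd_gid_apply]

@[simp]
lemma toEnd_mul_gid (f : GMap X Y n) : toEnd f * toEnd (gid X) = toEnd f := by
  refine toEnd_ext Y ?_ (fun w T Z h => toEnd_apply_of_ne _ w T h) ?_
  · intro w T Z h
    simp [toEnd_apply_of_ne _ _ T h]
  · intro w T j
    simp [toEnd_apply _ _ T (sub_add_cancel j n), toEnd_gid_apply]

/-- A graded map of degree `0` given by its components in the same degree. -/
def ofComponents (c : ∀ i, X i ⟶ Y i) : GMap X Y 0 :=
  fun i => c i ≫ eqToHom (congrArg Y (add_zero i).symm)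

lemma gcomp_ofComponents_eq_gid {c : ∀ i, X i ⟶ Y i} {c' : ∀ i, Y i ⟶ X i}
    (h : ∀ i, c i ≫ c' i = 𝟙 (X i)) :
    gcomp (show (0 : ℤ) + 0 = 0 by omega) (ofComponents c) (ofComponents c') = gid X := by
  apply toEnd_injective
  rw [toEnd_gcomp]
  refine toEnd_ext X (fun w T Z h => toEnd_apply_of_ne _ _ T h)
    (fun w T Z h => toEnd_apply_of_ne _ w T h) ?_
  intro w T j
  simp [toEnd_apply _ _ T (add_zero j), ofComponents, h, gid]

@[simp]
lemma toEnd_gdelta_zero (dX : GMap X X 1) (dY : GMap Y Y 1) (h : (0 : ℤ) + 1 = m)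
    (f : GMap X Y 0) :
    toEnd (gdelta dX dY h f) = toEnd dY * toEnd f - toEnd f * toEnd dX := by
  simp [gdelta]

@[simp]
lemma toEnd_gdelta_neg_one (dX : GMap X X 1) (dY : GMap Y Y 1) (h : (-1 : ℤ) + 1 = m)
    (f : GMap X Y (-1)) :
    toEnd (gdelta dX dY h f) = toEnd dY * toEnd f + toEnd f * toEnd dX := by
  simp [gdelta]

@[simp]
lemma gcomp_zero (h : n + m = k) (f : GMap X Y n) : gcomp h f (0 : GMap Y Z m) = 0 :=
  toEnd_injective (by simp)

@[simp]
lemma zero_gcomp (h : n + m = k) (g : GMap Y Z m) : gcomp h (0 : GMap X Y n) g = 0 :=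
  toEnd_injective (by simp)

end toEnd

section Fmap

variable {A B : Type*} [Category A] [Category B] (F : B ⥤ A) {X Y Z : GradedObj B} {n m k : ℤ}

@[simp]
lemma Fmap_gcomp (h : n + m = k) (f : GMap X Y n) (g : GMap Y Z m) :
    Fmap F (gcomp h f g) = gcomp h (Fmap F f) (Fmap F g) := by
  funext i
  simp [Fmap, gcomp, eqToHom_map]

@[simp]
lemma Fmap_gid : Fmap F (gid X) = gid (Fgr F X) := by
  funext i
  simp [Fmap, gid, eqToHom_map]

lemma Fmap_surjective [F.Full] : Function.Surjective (Fmap F : GMap X Y n → _) := by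
  intro y
  choose f hf using fun i => F.map_surjective (y i)
  exact ⟨f, funext hf⟩

variable [Preadditive A] [Preadditive B]

lemma KerSq.toEnd_mul_eq_zero {F : B ⥤ A} (hF : KerSq F) {f : GMap X Y n} {g : GMap Y Z m}
    (hf : Fmap F f = 0) (hg : Fmap F g = 0) : toEnd g * toEnd f = 0 := by
  rw [← toEnd_gcomp rfl, ← toEnd_zero (X := X) (Y := Z) (n := n + m)]
  congr 1
  funext i
  have := hF (f i) (g (i + n)) (congrFun hf i) (congrFun hg _)
  simp [gcomp, reassoc_of% this]

variable [F.Additive]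

@[simp]
lemma Fmap_add (f g : GMap X Y n) : Fmap F (f + g) = Fmap F f + Fmap F g := by
  funext i
  simp [Fmap]

@[simp]
lemma Fmap_sub (f g : GMap X Y n) : Fmap F (f - g) = Fmap F f - Fmap F g := by
  funext i
  simp [Fmap]

lemma Fmap_gdelta (dX : GMap X X 1) (dY : GMap Y Y 1) (h : n + 1 = m) (f : GMap X Y n) :
    Fmap F (gdelta dX dY h f) = gdelta (Fmap F dX) (Fmap F dY) h (Fmap F f) := by
  have hz (z : ℤ) (g : GMap X Y m) : Fmap F (z • g) = z • Fmap F g := by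
    funext i
    simp [Fmap, F.map_zsmul]
  simp [gdelta, hz]

end Fmap

section Ring

variable {R : Type*} [Ring R] {x d f g H K p q : R}

lemma sq_add_correction_eq_zero (hd : d * d = 0) (hp : p * x = x)
    (h₁ : (g * (d * f - f * x) - H * (x * x)) * (g * (d * f - f * x) - H * (x * x)) = 0)
    (h₂ : (x * g - g * d) * (d * f - f * x) = 0)
    (h₃ : (x * H + H * x - (p - g * f)) * (x * x) = 0) :
    (x + (g * (d * f - f * x) - H * (x * x))) * (x + (g * (d * f - f * x) - H * (x * x))) = 0 := by
  linear_combination (norm := noncomm_ring) h₁ + h₂ + g * hd * f - h₃ - hp * x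

lemma sq_add_mul_eq_zero (hx : x * x = 0) (hd : d * d = 0)
    (h₁ : (g * (d * f - f * x)) * (g * (d * f - f * x)) = 0)
    (h₂ : (x * g - g * d) * (d * f - f * x) = 0) :
    (x + g * (d * f - f * x)) * (x + g * (d * f - f * x)) = 0 := by
  linear_combination (norm := noncomm_ring) h₁ + h₂ + hx + g * hd * f - g * f * hx

lemma corrected_map_commutes (hx : x * x = 0) (hd : d * d = 0)
    (hq : q * (d * f - f * x) = d * f - f * x)
    (h₁ : (K * (d * f - f * x)) * (g * (d * f - f * x)) = 0)
    (h₂ : (d * K + K * d - (q - f * g)) * (d * f - f * x) = 0) :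
    d * (f - K * (d * f - f * x)) -
      (f - K * (d * f - f * x)) * (x + g * (d * f - f * x)) = 0 := by
  linear_combination (norm := noncomm_ring) h₁ - h₂ - hq + K * hd * f - K * f * hx

lemma corrected_inverse_commutes (hx : x * x = 0) (hd : d * d = 0) (hf : d * f - f * x = 0)
    (hpx : p * x = x) (hxp : x * p = x) (hq : (x * g - g * d) * q = x * g - g * d)
    (h₁ : (x * H + H * x - (p - g * f)) * (x * g - g * d) = 0)
    (h₂ : (x * g - g * d) * (d * K + K * d - (q - f * g)) = 0) :
    x * (g - ((x * H + H * x - (p - g * f)) * g - (x * g - g * d) * K)) -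
      (g - ((x * H + H * x - (p - g * f)) * g - (x * g - g * d) * K)) * d = 0 := by
  linear_combination (norm := noncomm_ring) -h₂ - hq + hx * g * K - g * hd * K - h₁ - hx * H * g +
    H * hx * g + hxp * g - hpx * g - g * hf * g

lemma homotopy_defect_commutes (hd : d * d = 0) (hf : d * f - f * x = 0) (hg : x * g - g * d = 0)
    (hdq : d * q = d) (hqd : q * d = d) :
    d * (d * K + K * d - (q - f * g)) = (d * K + K * d - (q - f * g)) * d := by
  linear_combination (norm := noncomm_ring) hd * K - K * hd - hdq + hqd + hf * g + f * hg

lemma unipotent_correction_commutes {i : R} (hg : x * g - g * d = 0) (hxi : x * i = i * x) :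
    x * (g - i * g) - (g - i * g) * d = 0 := by
  linear_combination (norm := noncomm_ring) hg - i * hg - hxi * g

lemma unipotent_correction_left {i : R} (hi : x * H + H * x - (p - g * f) = i)
    (hxi : x * i = i * x) (hii : i * i = 0) (hip : i * p = i) :
    x * (H - i * H) + (H - i * H) * x = p - (g - i * g) * f := by
  linear_combination (norm := noncomm_ring) hi - i * hi - hii - hip - hxi * H

lemma unipotent_correction_right {i k : R} (hi : x * H + H * x - (p - g * f) = i)
    (hk : d * K + K * d - (q - f * g) = k) (hf : d * f - f * x = 0) (hg : x * g - g * d = 0)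
    (hdk : d * k = k * d) (hkk : k * k = 0) (hkq : k * q = k) (hfp : f * p = f)
    (hqf : q * f = f) :
    d * (K - k * K + f * H * g - K * f * g) + (K - k * K + f * H * g - K * f * g) * d =
      q - f * (g - i * g) := by
  linear_combination (norm := noncomm_ring) hk - k * hk - hkk - hkq - hdk * K + f * hi * g -
    hk * f * g + hf * H * g - f * H * hg + K * hf * g + K * f * hg + (hfp - hqf) * g

end Ring

section Lift

lemma int_one_add_one : (1 : ℤ) + 1 = 2 := rfl

variable {A B : Type*} [Category A] [Category B] [Preadditive A] [Preadditive B] {F : B ⥤ A}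
  [F.Additive] {X Y : GradedObj B}

/-- If a pre-differential `x` on `X` becomes, after applying `F`, the differential of a complex
that is a homotopy retract of the image of a complex `(Y, d)`, then `x` can be corrected to a
differential. -/
lemma KerSq.exists_differential (hF : KerSq F) (x : GMap X X 1) {d : GMap Y Y 1}
    (hd : gcomp int_one_add_one d d = 0) (f : GMap X Y 0) (g : GMap Y X 0)
    (H : GMap X X (-1))
    (hx : gcomp int_one_add_one (Fmap F x) (Fmap F x) = 0)
    (hf : gdelta (Fmap F x) (Fmap F d) (show (0 : ℤ) + 1 = 1 by omega) (Fmap F f) = 0)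
    (hg : gdelta (Fmap F d) (Fmap F x) (show (0 : ℤ) + 1 = 1 by omega) (Fmap F g) = 0)
    (hH : gdelta (Fmap F x) (Fmap F x) (show (-1 : ℤ) + 1 = 0 by omega) (Fmap F H) =
      gid (Fgr F X) - gcomp (show (0 : ℤ) + 0 = 0 by omega) (Fmap F f) (Fmap F g)) :
    ∃ x' : GMap X X 1, Fmap F x' = Fmap F x ∧
      gcomp int_one_add_one x' x' = 0 := by
  let o : GMap X X 2 := gcomp int_one_add_one x x
  let e : GMap X Y 1 := gdelta x d (by omega) f
  let ε : GMap Y X 1 := gdelta d x (by omega) g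
  let i : GMap X X 0 := gdelta x x (by omega) H - (gid X - gcomp (by omega) f g)
  let a : GMap X X 1 := gcomp (by omega) e g - gcomp (by omega) o H
  have ho : Fmap F o = 0 := by simp [o, hx]
  have he : Fmap F e = 0 := by simp [e, Fmap_gdelta, hf]
  have hε : Fmap F ε = 0 := by simp [ε, Fmap_gdelta, hg]
  have hi : Fmap F i = 0 := by simp [i, Fmap_gdelta, hH]
  have ha : Fmap F a = 0 := by simp [a, he, ho]
  refine ⟨x + a, by simp [ha], toEnd_injective ?_⟩
  have haa := hF.toEnd_mul_eq_zero ha ha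
  have hεe := hF.toEnd_mul_eq_zero he hε
  have hio := hF.toEnd_mul_eq_zero ho hi
  simp only [a, e, o, i, ε, toEnd_sub, toEnd_add, toEnd_gcomp, toEnd_gdelta_zero,
    toEnd_gdelta_neg_one] at haa hεe hio ⊢
  rw [toEnd_zero]
  exact sq_add_correction_eq_zero (by simpa using congrArg toEnd hd) (toEnd_gid_mul x) haa hεe hio

/-- A map between complexes that becomes, after applying `F`, a cochain map with a right homotopy
inverse can be corrected, together with the differential of its source, to a cochain map. -/
lemma KerSq.exists_cochain_map (hF : KerSq F) {x : GMap X X 1} {d : GMap Y Y 1}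
    (hx : gcomp int_one_add_one x x = 0)
    (hd : gcomp int_one_add_one d d = 0) (f : GMap X Y 0) (g : GMap Y X 0)
    (K : GMap Y Y (-1))
    (hf : gdelta (Fmap F x) (Fmap F d) (show (0 : ℤ) + 1 = 1 by omega) (Fmap F f) = 0)
    (hg : gdelta (Fmap F d) (Fmap F x) (show (0 : ℤ) + 1 = 1 by omega) (Fmap F g) = 0)
    (hK : gdelta (Fmap F d) (Fmap F d) (show (-1 : ℤ) + 1 = 0 by omega) (Fmap F K) =
      gid (Fgr F Y) - gcomp (show (0 : ℤ) + 0 = 0 by omega) (Fmap F g) (Fmap F f)) :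
    ∃ (x' : GMap X X 1) (f' : GMap X Y 0), Fmap F x' = Fmap F x ∧ Fmap F f' = Fmap F f ∧
      gcomp int_one_add_one x' x' = 0 ∧
      gdelta x' d (show (0 : ℤ) + 1 = 1 by omega) f' = 0 := by
  let e : GMap X Y 1 := gdelta x d (by omega) f
  let ε : GMap Y X 1 := gdelta d x (by omega) g
  let k : GMap Y Y 0 := gdelta d d (by omega) K - (gid Y - gcomp (by omega) g f)
  let c : GMap X X 1 := gcomp (by omega) e g
  let b : GMap X Y 0 := gcomp (by omega) e K
  have he : Fmap F e = 0 := by simp [e, Fmap_gdelta, hf]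
  have hε : Fmap F ε = 0 := by simp [ε, Fmap_gdelta, hg]
  have hk : Fmap F k = 0 := by simp [k, Fmap_gdelta, hK]
  have hc : Fmap F c = 0 := by simp [c, he]
  have hb : Fmap F b = 0 := by simp [b, he]
  have hcc := hF.toEnd_mul_eq_zero hc hc
  have hbc := hF.toEnd_mul_eq_zero hc hb
  have hεe := hF.toEnd_mul_eq_zero he hε
  have hke := hF.toEnd_mul_eq_zero he hk
  have hqe : toEnd (gid Y) * toEnd e = toEnd e := toEnd_gid_mul e
  have hxx : toEnd x * toEnd x = 0 := by simpa using congrArg toEnd hx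
  have hdd : toEnd d * toEnd d = 0 := by simpa using congrArg toEnd hd
  simp only [b, c, e, k, ε, toEnd_sub, toEnd_gcomp, toEnd_gdelta_zero,
    toEnd_gdelta_neg_one] at hcc hbc hεe hke hqe
  refine ⟨x + c, f - b, by simp [hc], by simp [hb], toEnd_injective ?_, toEnd_injective ?_⟩
  · simpa only [c, e, toEnd_gcomp, toEnd_add, toEnd_gdelta_zero, toEnd_zero] using
      sq_add_mul_eq_zero hxx hdd hcc hεe
  · simpa only [b, c, e, toEnd_gcomp, toEnd_add, toEnd_sub, toEnd_gdelta_zero, toEnd_zero] using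
      corrected_map_commutes hxx hdd hqe hbc hke

/-- A map that becomes, after applying `F`, a homotopy inverse of the image of a cochain map `f`
can be corrected to a cochain map. -/
lemma KerSq.exists_cochain_map_inverse (hF : KerSq F) {x : GMap X X 1} {d : GMap Y Y 1}
    (hx : gcomp int_one_add_one x x = 0)
    (hd : gcomp int_one_add_one d d = 0) {f : GMap X Y 0}
    (hf : gdelta x d (show (0 : ℤ) + 1 = 1 by omega) f = 0) (g : GMap Y X 0)
    (H : GMap X X (-1)) (K : GMap Y Y (-1))
    (hg : gdelta (Fmap F d) (Fmap F x) (show (0 : ℤ) + 1 = 1 by omega) (Fmap F g) = 0)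
    (hH : gdelta (Fmap F x) (Fmap F x) (show (-1 : ℤ) + 1 = 0 by omega) (Fmap F H) =
      gid (Fgr F X) - gcomp (show (0 : ℤ) + 0 = 0 by omega) (Fmap F f) (Fmap F g))
    (hK : gdelta (Fmap F d) (Fmap F d) (show (-1 : ℤ) + 1 = 0 by omega) (Fmap F K) =
      gid (Fgr F Y) - gcomp (show (0 : ℤ) + 0 = 0 by omega) (Fmap F g) (Fmap F f)) :
    ∃ g' : GMap Y X 0, Fmap F g' = Fmap F g ∧
      gdelta d x (show (0 : ℤ) + 1 = 1 by omega) g' = 0 := by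
  let ε : GMap Y X 1 := gdelta d x (by omega) g
  let i : GMap X X 0 := gdelta x x (by omega) H - (gid X - gcomp (by omega) f g)
  let k : GMap Y Y 0 := gdelta d d (by omega) K - (gid Y - gcomp (by omega) g f)
  let b : GMap Y X 0 := gcomp (by omega) g i - gcomp (by omega) K ε
  have hε : Fmap F ε = 0 := by simp [ε, Fmap_gdelta, hg]
  have hi : Fmap F i = 0 := by simp [i, Fmap_gdelta, hH]
  have hk : Fmap F k = 0 := by simp [k, Fmap_gdelta, hK]
  have hb : Fmap F b = 0 := by simp [b, hi, hε]
  have hiε := hF.toEnd_mul_eq_zero hε hi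
  have hεk := hF.toEnd_mul_eq_zero hk hε
  have hεq : toEnd ε * toEnd (gid Y) = toEnd ε := toEnd_mul_gid ε
  simp only [i, k, ε, toEnd_sub, toEnd_gcomp, toEnd_gdelta_zero,
    toEnd_gdelta_neg_one] at hiε hεk hεq
  refine ⟨g - b, by simp [hb], toEnd_injective ?_⟩
  simpa only [b, i, ε, toEnd_gcomp, toEnd_sub, toEnd_gdelta_zero, toEnd_gdelta_neg_one,
    toEnd_zero] using corrected_inverse_commutes (by simpa using congrArg toEnd hx)
      (by simpa using congrArg toEnd hd) (by simpa using congrArg toEnd hf) (toEnd_gid_mul x)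
      (toEnd_mul_gid x) hεq hiε hεk

/-- Two cochain maps that become homotopy inverse to each other after applying `F` can be made
homotopy inverse to each other by correcting one of them. -/
lemma KerSq.exists_isHomotopyEquivPair (hF : KerSq F) {x : GMap X X 1} {d : GMap Y Y 1}
    (hx : gcomp int_one_add_one x x = 0)
    (hd : gcomp int_one_add_one d d = 0) {f : GMap X Y 0} {g : GMap Y X 0}
    (hf : gdelta x d (show (0 : ℤ) + 1 = 1 by omega) f = 0)
    (hg : gdelta d x (show (0 : ℤ) + 1 = 1 by omega) g = 0)
    (H : GMap X X (-1)) (K : GMap Y Y (-1))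
    (hH : gdelta (Fmap F x) (Fmap F x) (show (-1 : ℤ) + 1 = 0 by omega) (Fmap F H) =
      gid (Fgr F X) - gcomp (show (0 : ℤ) + 0 = 0 by omega) (Fmap F f) (Fmap F g))
    (hK : gdelta (Fmap F d) (Fmap F d) (show (-1 : ℤ) + 1 = 0 by omega) (Fmap F K) =
      gid (Fgr F Y) - gcomp (show (0 : ℤ) + 0 = 0 by omega) (Fmap F g) (Fmap F f)) :
    ∃ g' : GMap Y X 0, IsHomotopyEquivPair x d f g' := by
  let i : GMap X X 0 := gdelta x x (by omega) H - (gid X - gcomp (by omega) f g)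
  let k : GMap Y Y 0 := gdelta d d (by omega) K - (gid Y - gcomp (by omega) g f)
  have hi : Fmap F i = 0 := by simp [i, Fmap_gdelta, hH]
  have hk : Fmap F k = 0 := by simp [k, Fmap_gdelta, hK]
  have hii := hF.toEnd_mul_eq_zero hi hi
  have hkk := hF.toEnd_mul_eq_zero hk hk
  have hxx : toEnd x * toEnd x = 0 := by simpa using congrArg toEnd hx
  have hdd : toEnd d * toEnd d = 0 := by simpa using congrArg toEnd hd
  have hfe : toEnd d * toEnd f - toEnd f * toEnd x = 0 := by simpa using congrArg toEnd hf
  have hge : toEnd x * toEnd g - toEnd g * toEnd d = 0 := by simpa using congrArg toEnd hg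
  have hie : toEnd x * toEnd H + toEnd H * toEnd x - (toEnd (gid X) - toEnd g * toEnd f) =
      toEnd i := by simp [i]
  have hke : toEnd d * toEnd K + toEnd K * toEnd d - (toEnd (gid Y) - toEnd f * toEnd g) =
      toEnd k := by simp [k]
  have hxi : toEnd x * toEnd i = toEnd i * toEnd x := hie ▸
    homotopy_defect_commutes hxx hge hfe (toEnd_mul_gid x) (toEnd_gid_mul x)
  have hdk : toEnd d * toEnd k = toEnd k * toEnd d := hke ▸
    homotopy_defect_commutes hdd hfe hge (toEnd_mul_gid d) (toEnd_gid_mul d)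
  refine ⟨g - gcomp (by omega) g i, hf, toEnd_injective ?_,
    ⟨H - gcomp (by omega) H i, toEnd_injective ?_⟩,
    ⟨K - gcomp (by omega) K k + gcomp (show -1 + 0 = -1 by omega) (gcomp (by omega) g H) f -
      gcomp (show 0 + -1 = -1 by omega) (gcomp (by omega) g f) K, toEnd_injective ?_⟩⟩
  · simp only [toEnd_gdelta_zero, toEnd_sub, toEnd_gcomp, toEnd_zero]
    exact unipotent_correction_commutes hge hxi
  · simpa using unipotent_correction_left hie hxi hii (toEnd_mul_gid i)
  · simpa [mul_assoc] using unipotent_correction_right hie hke hfe hge hdk hkk (toEnd_mul_gid k)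
      (toEnd_mul_gid f) (toEnd_gid_mul f)

end Lift

/-- Corollary `formsmooth`: if `F` is moreover essentially surjective, the
natural functor from lifts along `C(F)` to lifts along `K(F)` is essentially surjective:
every complex `(D̄,d̄_D)` in `𝒞̄` homotopy equivalent to `(C,d)` after applying `F` can be
replaced by a complex `(Ē,d̄_E)` whose image under `F` is strictly isomorphic to `(C,d)`,
together with a homotopy equivalence `(Ē,d̄_E) → (D̄,d̄_D)` compatible with `φ` up to
homotopy. -/
theorem statement17 {B C : Type*} [Category B] [Preadditive B] [Category C] [Preadditive C]
    (F : B ⥤ C) [F.Additive] [F.Full] [F.EssSurj] (hF : KerSq F)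
    (Cg : GradedObj C)
    (d : GMap Cg Cg 1)
    (hd : gcomp (show (1:ℤ) + 1 = 2 by omega) d d = 0)
    (Yb : GradedObj B) (dYb : GMap Yb Yb 1)
    (hdY : gcomp (show (1:ℤ) + 1 = 2 by omega) dYb dYb = 0)
    (φ : GMap Cg (Fgr F Yb) 0) (φ' : GMap (Fgr F Yb) Cg 0)
    (hφ : IsHomotopyEquivPair d (Fmap F dYb) φ φ') :
    ∃ (Eb : GradedObj B) (dEb : GMap Eb Eb 1),
      gcomp (show (1:ℤ) + 1 = 2 by omega) dEb dEb = 0 ∧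
      -- a strict isomorphism of complexes `(C,d) ≅ F(Ē,d̄_E)`
      ∃ (u : GMap Cg (Fgr F Eb) 0) (u' : GMap (Fgr F Eb) Cg 0),
        gdelta d (Fmap F dEb) (show (0:ℤ) + 1 = 1 by omega) u = 0 ∧
        gdelta (Fmap F dEb) d (show (0:ℤ) + 1 = 1 by omega) u' = 0 ∧
        gcomp (show (0:ℤ) + 0 = 0 by omega) u u' = gid Cg ∧
        gcomp (show (0:ℤ) + 0 = 0 by omega) u' u = gid (Fgr F Eb) ∧
        -- a homotopy equivalence `(Ē,d̄_E) → (D̄,d̄_D)` compatible with `φ` up to homotopy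
        ∃ (v : GMap Eb Yb 0) (v' : GMap Yb Eb 0),
          IsHomotopyEquivPair dEb dYb v v' ∧
          ∃ h : GMap Cg (Fgr F Yb) (-1),
            gdelta d (Fmap F dYb) (show (-1:ℤ) + 1 = 0 by omega) h
              = φ - gcomp (show (0:ℤ) + 0 = 0 by omega) u (Fmap F v) := by
  let E : GradedObj B := fun i => F.objPreimage (Cg i)
  let u : GMap Cg (Fgr F E) 0 := ofComponents fun i => (F.objObjPreimageIso (Cg i)).inv
  let u' : GMap (Fgr F E) Cg 0 := ofComponents fun i => (F.objObjPreimageIso (Cg i)).hom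
  have huu' : gcomp (show (0 : ℤ) + 0 = 0 by omega) u u' = gid Cg :=
    gcomp_ofComponents_eq_gid (by simp)
  have hu'u : gcomp (show (0 : ℤ) + 0 = 0 by omega) u' u = gid (Fgr F E) :=
    gcomp_ofComponents_eq_gid (by simp)
  clear_value u u'
  obtain ⟨hφd, hφ'd, ⟨H, hH⟩, ⟨K, hK⟩⟩ := hφ
  obtain ⟨x, hx⟩ := Fmap_surjective F
    (gcomp (show 0 + 1 = 1 by omega) u' (gcomp (show 1 + 0 = 1 by omega) d u))
  obtain ⟨f, hf⟩ := Fmap_surjective F (gcomp (show (0 : ℤ) + 0 = 0 by omega) u' φ)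
  obtain ⟨g, hg⟩ := Fmap_surjective F (gcomp (show (0 : ℤ) + 0 = 0 by omega) φ' u)
  obtain ⟨H', hH'⟩ := Fmap_surjective F
    (gcomp (show 0 + -1 = -1 by omega) u' (gcomp (show -1 + 0 = -1 by omega) H u))
  obtain ⟨K', hK'⟩ := Fmap_surjective F K
  have tuu' : toEnd u' * toEnd u = toEnd (gid Cg) := by simpa using congrArg toEnd huu'
  have tu'u : toEnd u * toEnd u' = toEnd (gid (Fgr F E)) := by simpa using congrArg toEnd hu'u
  have td : toEnd d * toEnd d = 0 := by simpa using congrArg toEnd hd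
  have tφ : toEnd (Fmap F dYb) * toEnd φ - toEnd φ * toEnd d = 0 := by
    simpa using congrArg toEnd hφd
  have tφ' : toEnd d * toEnd φ' - toEnd φ' * toEnd (Fmap F dYb) = 0 := by
    simpa using congrArg toEnd hφ'd
  have tH : toEnd d * toEnd H + toEnd H * toEnd d = toEnd (gid Cg) - toEnd φ' * toEnd φ := by
    simpa using congrArg toEnd hH
  -- The image of `gid Cg` is a unit only for graded maps from or to `Cg`, hence these two rules.
  have cancel {Y : GradedObj C} {n : ℤ} (r : GMap Cg Y n) (s : AddMonoid.End (Probes C)) :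
      toEnd r * (toEnd u' * (toEnd u * s)) = toEnd r * s := by
    rw [← mul_assoc (toEnd u'), tuu', ← mul_assoc, toEnd_mul_gid]
  have cancel_right {Y : GradedObj C} {n : ℤ} (r : GMap Cg Y n) :
      toEnd r * (toEnd u' * toEnd u) = toEnd r := by
    rw [tuu', toEnd_mul_gid]
  have hxx : gcomp (show (1 : ℤ) + 1 = 2 by omega) (Fmap F x) (Fmap F x) = 0 := by
    apply toEnd_injective
    rw [hx]
    simp only [toEnd_gcomp, toEnd_zero]
    simp only [mul_assoc, cancel]
    rw [← mul_assoc (toEnd d), td, zero_mul, mul_zero]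
  have hxf : gdelta (Fmap F x) (Fmap F dYb) (show (0 : ℤ) + 1 = 1 by omega) (Fmap F f) = 0 := by
    apply toEnd_injective
    rw [hx, hf]
    simp only [toEnd_gcomp, toEnd_gdelta_zero, toEnd_zero]
    rw [mul_assoc (toEnd φ), mul_assoc (toEnd u), cancel, ← mul_assoc, ← mul_assoc, ← sub_mul, tφ,
      zero_mul]
  have hxg : gdelta (Fmap F dYb) (Fmap F x) (show (0 : ℤ) + 1 = 1 by omega) (Fmap F g) = 0 := by
    apply toEnd_injective
    rw [hx, hg]
    simp only [toEnd_gcomp, toEnd_gdelta_zero, toEnd_zero]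
    rw [mul_assoc, mul_assoc, cancel, mul_assoc, ← mul_sub, tφ', mul_zero]
  have hxH : gdelta (Fmap F x) (Fmap F x) (show (-1 : ℤ) + 1 = 0 by omega) (Fmap F H') =
      gid (Fgr F E) - gcomp (show (0 : ℤ) + 0 = 0 by omega) (Fmap F f) (Fmap F g) := by
    apply toEnd_injective
    rw [hx, hf, hg, hH']
    simp only [toEnd_gcomp, toEnd_gdelta_neg_one, toEnd_sub]
    simp only [mul_assoc, cancel]
    rw [← mul_add, ← mul_assoc, ← mul_assoc, ← add_mul, tH, sub_mul, toEnd_gid_mul, mul_sub, tu'u,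
      mul_assoc]
  have hYK : gdelta (Fmap F dYb) (Fmap F dYb) (show (-1 : ℤ) + 1 = 0 by omega) (Fmap F K') =
      gid (Fgr F Yb) - gcomp (show (0 : ℤ) + 0 = 0 by omega) (Fmap F g) (Fmap F f) := by
    rw [hK', hK, hf, hg]
    apply toEnd_injective
    simp only [toEnd_gcomp, toEnd_sub]
    rw [mul_assoc (toEnd φ), cancel]
  obtain ⟨x₁, hx₁, hx₁x₁⟩ := hF.exists_differential x hdY f g H' hxx hxf hxg hxH
  rw [← hx₁] at hxf hxg hxH
  obtain ⟨x₂, f', hx₂, hf', hx₂x₂, hx₂f'⟩ :=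
    hF.exists_cochain_map hx₁x₁ hdY f g K' hxf hxg hYK
  rw [← hx₂] at hxg hxH
  rw [← hf'] at hxH hYK
  obtain ⟨g', hg', hx₂g'⟩ := hF.exists_cochain_map_inverse hx₂x₂ hdY hx₂f' g H' K' hxg hxH hYK
  rw [← hg'] at hxH hYK
  obtain ⟨v', hv'⟩ := hF.exists_isHomotopyEquivPair hx₂x₂ hdY hx₂f' hx₂g' H' K' hxH hYK
  refine ⟨E, x₂, hx₂x₂, u, u', toEnd_injective ?_, toEnd_injective ?_, huu', hu'u, f', v', hv', 0,
    toEnd_injective ?_⟩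
  · rw [hx₂, hx₁, hx]
    simp only [toEnd_gcomp, toEnd_gdelta_zero, toEnd_zero]
    rw [mul_assoc, mul_assoc, cancel_right, sub_self]
  · rw [hx₂, hx₁, hx]
    simp only [toEnd_gcomp, toEnd_gdelta_zero, toEnd_zero]
    rw [← mul_assoc, ← mul_assoc, tuu', toEnd_gid_mul, sub_self]
  · rw [hf', hf]
    simp only [toEnd_gcomp, toEnd_gdelta_neg_one, toEnd_zero, toEnd_sub]
    simp [mul_assoc, cancel_right]

end Paper
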